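/- Let n ≥ 1, m ≥ 1 and 1 ≤ r ≤ m be integers. Let d = gcd(r,m) and let k be the unique integer with 0 ≤ k ≤ m/d − 1 and r·k ≡ d (mod m). Define n' = d, m' = n·m/d and r' = n·(m/d − k). Let d' = gcd(r', m') and let k' be the unique integer with 0 ≤ k' ≤ m'/d' − 1 and r'·k' ≡ d' (mod m'). Then d' = n, m'·n'/d' = m, and n'·(m'/d' − k') = r. (In other words, the duality operation (n,m,r) ↦ (d, nm/d, n(m/d − k)) on parameters of quadriculated tori is an involution: T**(n,m,r) = T(n,m,r).) -/

import Mathlib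

/-- The duality operation (n,m,r) ↦ (d, nm/d, n(m/d − k)) on parameters of quadriculated
tori is an involution: with d = gcd(r,m), k the unique integer with 0 ≤ k ≤ m/d − 1 and
r·k ≡ d (mod m), n' = d, m' = nm/d, r' = n(m/d − k), d' = gcd(r',m'), and k' the unique
integer with 0 ≤ k' ≤ m'/d' − 1 and r'·k' ≡ d' (mod m'), one has d' = n, m'n'/d' = m and
n'(m'/d' − k') = r. -/
theorem torus_duality_involution (n m r d k n' m' r' d' k' : ℤ)
    (hn : 1 ≤ n) (hm : 1 ≤ m) (hr1 : 1 ≤ r) (hrm : r ≤ m)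
    (hd : d = Int.gcd r m)
    (hk0 : 0 ≤ k) (hk1 : k ≤ m / d - 1) (hk : r * k ≡ d [ZMOD m])
    (hn' : n' = d) (hm' : m' = n * m / d) (hr' : r' = n * (m / d - k))
    (hd' : d' = Int.gcd r' m')
    (hk'0 : 0 ≤ k') (hk'1 : k' ≤ m' / d' - 1) (hk' : r' * k' ≡ d' [ZMOD m']) :
    d' = n ∧ m' * n' / d' = m ∧ n' * (m' / d' - k') = r := by
  have hd_pos : 0 < d := by
    rw [hd]
    exact_mod_cast Int.gcd_pos_of_ne_zero_left m (by omega)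
  obtain ⟨R, rfl⟩ : d ∣ r := hd ▸ Int.gcd_dvd_left r m
  obtain ⟨M, rfl⟩ : d ∣ m := hd ▸ Int.gcd_dvd_right (d * R) m
  have hM : d * M / d = M := Int.mul_ediv_cancel_left M hd_pos.ne'
  have hm'_eq : m' = n * M := by
    rw [hm', mul_left_comm, Int.mul_ediv_cancel_left _ hd_pos.ne']
  rw [hM] at hk1 hr'
  have hRk : M ∣ 1 - R * k := by
    have h := hk.dvd
    rw [show d - d * R * k = d * (1 - R * k) by ring] at h
    exact Int.dvd_of_mul_dvd_mul_left hd_pos.ne' h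
  obtain ⟨t, ht⟩ := hRk
  have hcop : IsCoprime (M - k) M := ⟨-R, t + R, by linear_combination -ht⟩
  have hd'_eq : d' = n := by
    rw [hd', hr', hm'_eq, Int.gcd_mul_left, Int.isCoprime_iff_gcd_eq_one.mp hcop, mul_one,
      Int.natCast_natAbs, abs_of_pos (by omega)]
  have hn0 : n ≠ 0 := by omega
  subst hd'_eq hm'_eq hr' hn'
  have hM' : d' * M / d' = M := Int.mul_ediv_cancel_left M hn0
  have hkk' : M ∣ 1 - (M - k) * k' := by
    have h := hk'.dvd
    rw [show d' - d' * (M - k) * k' = d' * (1 - (M - k) * k') by ring] at h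
    exact Int.dvd_of_mul_dvd_mul_left hn0 h
  rw [hM'] at hk'1 ⊢
  refine ⟨rfl, ?_, ?_⟩
  · rw [mul_assoc, Int.mul_ediv_cancel_left _ hn0, mul_comm]
  · obtain ⟨s, hs⟩ := hkk'
    have hR_pos : 0 < R := pos_of_mul_pos_right (by omega) hd_pos.le
    have hR_le : R ≤ M := le_of_mul_le_mul_left hrm hd_pos
    have hdvd : M ∣ M - k' - R :=
      ⟨1 - R * s - R * k' - k' * t, by linear_combination -R * hs - k' * ht⟩
    have hzero : M - k' - R = 0 :=
      Int.eq_zero_of_abs_lt_dvd hdvd (abs_lt.mpr ⟨by omega, by omega⟩)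
    rw [show M - k' = R by omega]
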